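/- Three-term recurrence relation for non-commutative Laurent bi-orthogonal polynomials (Theorem 4.6): for every k ∈ ℤ and n ≥ 1, assuming all Toeplitz matrices T and all quasi-determinants H, G occurring below are invertible (resp. nonzero), one has the equality of Laurent polynomials z·((Q_{n+1}^{(k)})* + (Q_n^{(k)})*·ψ_n^{(k)}) = (Q_n^{(k)})* + (Q_{n−1}^{(k)})*·(ψ_{n−1}^{(k)} − φ_{n−1}^{(k−1)}). -/

import Mathlib

/-- The `n × n` shifted Toeplitz matrix `T_n^{(k)} = (m(k + i − j))_{i,j=0}^{n−1}`. -/
noncomputable def Tmat {R : Type*} [DivisionRing R] (m : ℤ → R) (k : ℤ) (n : ℕ) :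
    Matrix (Fin n) (Fin n) R :=
  Matrix.of fun i j => m (k + (i.val : ℤ) - (j.val : ℤ))

/-- The Laurent polynomial `(Q_n^{(k)})*(z) = z^{−n} − Σ_{i=0}^{n−1} c_i z^{−i}`, where
`(c_0, …, c_{n−1})ᵀ = (T_n^{(k)})⁻¹·(m(k−n), …, m(k−1))ᵀ`, given as the coefficient
function `ℤ → R` (the value at `e` is the coefficient of `z^e`). -/
noncomputable def Qs {R : Type*} [DivisionRing R] (m : ℤ → R) (k : ℤ) (n : ℕ) :
    ℤ → R := fun e =>
  if e = -(n : ℤ) then 1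
  else if he : -(n : ℤ) < e ∧ e ≤ 0 then
    -(∑ j : Fin n, Ring.inverse (Tmat m k n) ⟨(-e).toNat, by omega⟩ j *
      m (k - (n : ℤ) + (j.val : ℤ)))
  else 0

/-- The quasi-determinant
`H_n^{(k)} = m(k) − (m(k+n), …, m(k+1))·(T_n^{(k)})⁻¹·(m(k−n), …, m(k−1))ᵀ`
(with `H_0^{(k)} = m(k)`). -/
noncomputable def Hq {R : Type*} [DivisionRing R] (m : ℤ → R) (n : ℕ) (k : ℤ) : R :=
  m k - ∑ j : Fin n, ∑ l : Fin n,
    m (k + (n : ℤ) - (j.val : ℤ)) * Ring.inverse (Tmat m k n) j l *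
      m (k - (n : ℤ) + (l.val : ℤ))

/-- The quasi-determinant
`G_n^{(k)} = m(k−n) − (m(k), …, m(k−n+1))·(T_n^{(k+1)})⁻¹·(m(k+1−n), …, m(k))ᵀ`
(with `G_0^{(k)} = m(k)`). -/
noncomputable def Gq {R : Type*} [DivisionRing R] (m : ℤ → R) (n : ℕ) (k : ℤ) : R :=
  m (k - (n : ℤ)) - ∑ j : Fin n, ∑ l : Fin n,
    m (k - (j.val : ℤ)) * Ring.inverse (Tmat m (k + 1) n) j l *
      m (k + 1 - (n : ℤ) + (l.val : ℤ))

/-- `ψ_n^{(k)} = (H_n^{(k)})⁻¹·H_n^{(k−1)}`. -/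
noncomputable def psi {R : Type*} [DivisionRing R] (m : ℤ → R) (n : ℕ) (k : ℤ) : R :=
  (Hq m n k)⁻¹ * Hq m n (k - 1)

/-- `φ_n^{(k)} = (G_n^{(k)})⁻¹·G_n^{(k−1)}`. -/
noncomputable def phi {R : Type*} [DivisionRing R] (m : ℤ → R) (n : ℕ) (k : ℤ) : R :=
  (Gq m n k)⁻¹ * Gq m n (k - 1)

/-- The linear functional `f ↦ Σ_{j<N} m(s-j) f(-j)`. -/
def Sf {R : Type*} [DivisionRing R] (m : ℤ → R) (N : ℕ) (s : ℤ) (f : ℤ → R) : R :=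
  ∑ j ∈ Finset.range N, m (s - (j : ℤ)) * f (-(j : ℤ))

section helpers
variable {R : Type*} [DivisionRing R]

theorem Qs_lead (m : ℤ → R) (k : ℤ) (n : ℕ) : Qs m k n (-(n : ℤ)) = 1 := by
  simp [Qs]

theorem Qs_out (m : ℤ → R) (k : ℤ) (n : ℕ) (e : ℤ) (h : e < -(n : ℤ) ∨ 0 < e) :
    Qs m k n e = 0 := by
  unfold Qs
  rw [if_neg (by omega), dif_neg (by omega)]

theorem Qs_mid (m : ℤ → R) (k : ℤ) (n : ℕ) (i : Fin n) :
    Qs m k n (-(i.val : ℤ)) = -(∑ j : Fin n, Ring.inverse (Tmat m k n) i j *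
      m (k - (n : ℤ) + (j.val : ℤ))) := by
  have hi := i.isLt
  unfold Qs
  rw [if_neg (by omega), dif_pos (by omega)]
  simp

theorem Sf_add (m : ℤ → R) (N : ℕ) (s : ℤ) (f g : ℤ → R) :
    Sf m N s (fun e => f e + g e) = Sf m N s f + Sf m N s g := by
  simp [Sf, mul_add, Finset.sum_add_distrib]

theorem Sf_sub (m : ℤ → R) (N : ℕ) (s : ℤ) (f g : ℤ → R) :
    Sf m N s (fun e => f e - g e) = Sf m N s f - Sf m N s g := by
  simp [Sf, mul_sub, Finset.sum_sub_distrib]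

theorem Sf_mul (m : ℤ → R) (N : ℕ) (s : ℤ) (f : ℤ → R) (a : R) :
    Sf m N s (fun e => f e * a) = Sf m N s f * a := by
  simp [Sf, Finset.sum_mul, mul_assoc]

theorem Sf_shift (m : ℤ → R) (N : ℕ) (s : ℤ) (f : ℤ → R) (h : f 1 = 0) :
    Sf m (N + 1) s (fun e => f (e + 1)) = Sf m N (s - 1) f := by
  unfold Sf
  rw [Finset.sum_range_succ']
  simp only [Nat.cast_zero, neg_zero, zero_add, h, mul_zero, add_zero]
  refine Finset.sum_congr rfl fun j _ => ?_
  congr 2 <;> push_cast <;> ring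

theorem Sf_succ (m : ℤ → R) (N : ℕ) (s : ℤ) (f : ℤ → R) (h : f (-(N : ℤ)) = 0) :
    Sf m (N + 1) s f = Sf m N s f := by
  simp [Sf, Finset.sum_range_succ, h]

theorem Sf_Qs (m : ℤ → R) (k : ℤ) (n : ℕ) (s : ℤ) :
    Sf m (n + 1) s (Qs m k n) = m (s - n) - ∑ j : Fin n, m (s - (j.val : ℤ)) *
      ∑ l : Fin n, Ring.inverse (Tmat m k n) j l * m (k - (n : ℤ) + (l.val : ℤ)) := by
  unfold Sf
  rw [Finset.sum_range_succ, Qs_lead, mul_one, Finset.sum_range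
    (fun j => m (s - (j : ℤ)) * Qs m k n (-(j : ℤ)))]
  simp only [Qs_mid, mul_neg, Finset.sum_neg_distrib]
  abel

theorem Sf_H (m : ℤ → R) (k : ℤ) (n : ℕ) :
    Sf m (n + 1) (k + n) (Qs m k n) = Hq m n k := by
  rw [Sf_Qs, Hq]
  simp [Finset.mul_sum, mul_assoc]

theorem Sf_G (m : ℤ → R) (k : ℤ) (n : ℕ) :
    Sf m (n + 1) (k - 1) (Qs m k n) = Gq m n (k - 1) := by
  rw [Sf_Qs, Gq]
  simp [Finset.mul_sum, mul_assoc]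

theorem Sf_orth (m : ℤ → R) (k : ℤ) (n : ℕ) (hT : IsUnit (Tmat m k n)) (i : ℕ) (hi : i < n) :
    Sf m (n + 1) (k + i) (Qs m k n) = 0 := by
  rw [Sf_Qs, sub_eq_zero]
  have h := congrArg (fun A => Matrix.mulVec A
    (fun l : Fin n => m (k - (n : ℤ) + (l.val : ℤ)))) (Ring.mul_inverse_cancel _ hT)
  simp only [← Matrix.mulVec_mulVec, Matrix.one_mulVec] at h
  have h2 := congrFun h ⟨i, hi⟩
  simp only [Matrix.mulVec, dotProduct, Tmat, Matrix.of_apply] at h2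
  rw [show k + (i : ℤ) - n = k - n + i by ring, ← h2]
  rfl

theorem Sf_uniq (m : ℤ → R) (k : ℤ) (n : ℕ) (hT : IsUnit (Tmat m k n)) (f : ℤ → R)
    (hf : ∀ i : ℕ, i < n → Sf m n (k + i) f = 0)
    (hout : ∀ e : ℤ, e ≤ -(n : ℤ) ∨ 0 < e → f e = 0) (e : ℤ) : f e = 0 := by
  by_cases he : e ≤ -(n : ℤ) ∨ 0 < e
  · exact hout e he
  have h0 : Matrix.mulVec (Tmat m k n) (fun j : Fin n => f (-(j.val : ℤ))) = 0 := by
    funext i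
    have := hf i i.isLt
    unfold Sf at this
    rw [Finset.sum_range (fun j => m (k + (i.val : ℤ) - (j : ℤ)) * f (-(j : ℤ)))] at this
    simpa [Matrix.mulVec, dotProduct, Tmat] using this
  have h := congrArg (fun v => Matrix.mulVec (Ring.inverse (Tmat m k n)) v) h0
  simp only [Matrix.mulVec_mulVec, Ring.inverse_mul_cancel _ hT, Matrix.one_mulVec,
    Matrix.mulVec_zero] at h
  have h2 := congrFun h ⟨(-e).toNat, by omega⟩
  simp only [Pi.zero_apply] at h2
  rwa [show -(((-e).toNat : ℕ) : ℤ) = e by omega] at h2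

/-- `Q_{n+1}^{(k)} + Q_n^{(k)} ψ_n^{(k)} = z⁻¹ Q_n^{(k-1)}`. -/
theorem aux_one (m : ℤ → R) (k : ℤ) (n : ℕ) (hT1 : IsUnit (Tmat m k (n + 1)))
    (hT2 : IsUnit (Tmat m k n)) (hT3 : IsUnit (Tmat m (k - 1) n)) (hH : Hq m n k ≠ 0) (e : ℤ) :
    Qs m k (n + 1) e + Qs m k n e * psi m n k = Qs m (k - 1) n (e + 1) := by
  rw [← sub_eq_zero]
  refine Sf_uniq m k (n + 1) hT1
    (fun e => (Qs m k (n + 1) e + Qs m k n e * psi m n k) - Qs m (k - 1) n (e + 1)) ?_ ?_ e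
  · have hlast : ∀ e : ℤ, e = -((n + 1 : ℕ) : ℤ) →
        (Qs m k (n + 1) e + Qs m k n e * psi m n k) - Qs m (k - 1) n (e + 1) = 0 := by
      rintro e rfl
      rw [Qs_lead, Qs_out m k n _ (by push_cast; omega),
        show -((n + 1 : ℕ) : ℤ) + 1 = -(n : ℤ) by push_cast; ring, Qs_lead]
      simp
    intro i hi
    rw [← Sf_succ m (n + 1) _ _ (hlast _ rfl)]
    rw [Sf_sub, Sf_add, Sf_mul, Sf_orth m k (n + 1) hT1 i hi,
      Sf_shift m (n + 1) _ (Qs m (k - 1) n) (Qs_out _ _ _ _ (by omega)),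
      Sf_succ m (n + 1) _ (Qs m k n) (Qs_out _ _ _ _ (by push_cast; omega)),
      show k + (i : ℤ) - 1 = k - 1 + i by ring]
    rcases Nat.lt_succ_iff_lt_or_eq.mp hi with h | rfl
    · rw [Sf_orth m k n hT2 i h, Sf_orth m (k - 1) n hT3 i h]; simp
    · rw [Sf_H, Sf_H, psi, mul_inv_cancel_left₀ hH]; simp
  · intro e he
    by_cases h : e = -((n + 1 : ℕ) : ℤ)
    · subst h
      show (Qs m k (n + 1) _ + Qs m k n _ * psi m n k) - Qs m (k - 1) n _ = 0
      rw [Qs_lead, Qs_out m k n _ (by push_cast; omega),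
        show -((n + 1 : ℕ) : ℤ) + 1 = -(n : ℤ) by push_cast; ring, Qs_lead]
      simp
    · show (Qs m k (n + 1) _ + Qs m k n _ * psi m n k) - Qs m (k - 1) n _ = 0
      rw [Qs_out m k (n + 1) _ (by omega), Qs_out m k n _ (by omega),
        Qs_out m (k - 1) n _ (by omega)]
      simp

/-- `Q_{n+1}^{(k-1)} = Q_{n+1}^{(k)} + Q_n^{(k)} α`. -/
theorem aux_two (m : ℤ → R) (k : ℤ) (n : ℕ) (hT1 : IsUnit (Tmat m k (n + 1)))
    (hT2 : IsUnit (Tmat m k n)) (hT3 : IsUnit (Tmat m (k - 1) (n + 1)))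
    (hH : Hq m n k ≠ 0) (e : ℤ) :
    Qs m k (n + 1) e + Qs m k n e * ((Hq m n k)⁻¹ * Hq m (n + 1) (k - 1))
      = Qs m (k - 1) (n + 1) e := by
  rw [← sub_eq_zero]
  refine Sf_uniq m k (n + 1) hT1
    (fun e => (Qs m k (n + 1) e + Qs m k n e * ((Hq m n k)⁻¹ * Hq m (n + 1) (k - 1)))
      - Qs m (k - 1) (n + 1) e) ?_ ?_ e
  · have hlast : ∀ e : ℤ, e = -((n + 1 : ℕ) : ℤ) →
        (Qs m k (n + 1) e + Qs m k n e * ((Hq m n k)⁻¹ * Hq m (n + 1) (k - 1)))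
      - Qs m (k - 1) (n + 1) e = 0 := by
      rintro e rfl
      rw [Qs_lead, Qs_out m k n _ (by push_cast; omega), Qs_lead]
      simp
    intro i hi
    rw [← Sf_succ m (n + 1) _ _ (hlast _ rfl)]
    rw [Sf_sub, Sf_add, Sf_mul, Sf_orth m k (n + 1) hT1 i hi,
      Sf_succ m (n + 1) _ (Qs m k n) (Qs_out _ _ _ _ (by push_cast; omega)),
      show Sf m (n + 1 + 1) (k + i) (Qs m (k - 1) (n + 1))
        = Sf m (n + 1 + 1) (k - 1 + ((i + 1 : ℕ) : ℤ)) (Qs m (k - 1) (n + 1)) by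
          congr 1; push_cast; ring]
    rcases Nat.lt_succ_iff_lt_or_eq.mp hi with h | rfl
    · rw [Sf_orth m k n hT2 i h, Sf_orth m (k - 1) (n + 1) hT3 (i + 1) (by omega)]; simp
    · rw [Sf_H, Sf_H, mul_inv_cancel_left₀ hH]; simp
  · intro e he
    by_cases h : e = -((n + 1 : ℕ) : ℤ)
    · subst h
      show (Qs m k (n + 1) _ + Qs m k n _ * _) - Qs m (k - 1) (n + 1) _ = 0
      rw [Qs_lead, Qs_out m k n _ (by push_cast; omega), Qs_lead]
      simp
    · show (Qs m k (n + 1) _ + Qs m k n _ * _) - Qs m (k - 1) (n + 1) _ = 0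
      rw [Qs_out m k (n + 1) _ (by omega), Qs_out m k n _ (by omega),
        Qs_out m (k - 1) (n + 1) _ (by omega)]
      simp

end helpers

/-- Three-term recurrence relation for non-commutative Laurent bi-orthogonal polynomials:
`z·((Q_{n+1}^{(k)})* + (Q_n^{(k)})*·ψ_n^{(k)})
  = (Q_n^{(k)})* + (Q_{n−1}^{(k)})*·(ψ_{n−1}^{(k)} − φ_{n−1}^{(k−1)})`, coefficientwise. -/
theorem stmt_16 {R : Type*} [DivisionRing R] (m : ℤ → R) (k : ℤ) (n : ℕ) (hn : 1 ≤ n)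
    (hT1 : IsUnit (Tmat m k (n + 1)))
    (hT2 : IsUnit (Tmat m k n))
    (hT3 : IsUnit (Tmat m k (n - 1)))
    (hT4 : IsUnit (Tmat m (k - 1) n))
    (hT5 : IsUnit (Tmat m (k - 1) (n - 1)))
    (hH1 : Hq m n k ≠ 0)
    (hH2 : Hq m n (k - 1) ≠ 0)
    (hH3 : Hq m (n - 1) k ≠ 0)
    (hH4 : Hq m (n - 1) (k - 1) ≠ 0)
    (hG1 : Gq m (n - 1) (k - 1) ≠ 0)
    (hG2 : Gq m (n - 1) (k - 2) ≠ 0) :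
    ∀ r : ℤ,
      Qs m k (n + 1) (r - 1) + Qs m k n (r - 1) * psi m n k
        = Qs m k n r + Qs m k (n - 1) r * (psi m (n - 1) k - phi m (n - 1) (k - 1)) := by
  obtain ⟨n, rfl⟩ : ∃ p, n = p + 1 := ⟨n - 1, by omega⟩
  simp only [Nat.add_sub_cancel] at *
  intro r
  rw [aux_one m k (n + 1) hT1 hT2 hT4 hH1, sub_add_cancel]
  have h2 := aux_two m k n hT2 hT3 hT4 hH3
  have h1 := aux_one m k n hT2 hT3 hT5 hH3
  set a := (Hq m n k)⁻¹ * Hq m (n + 1) (k - 1) with ha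
  have key : a = psi m n k - phi m n (k - 1) := by
    have h3 : ∀ e, Qs m (k - 1) (n + 1) e
        = Qs m (k - 1) n (e + 1) + Qs m k n e * (a - psi m n k) := by
      intro e
      rw [← h2, ← h1, mul_sub]
      abel
    have h4 := Sf_orth m (k - 1) (n + 1) hT4 0 (by omega)
    rw [funext h3, Sf_add, Sf_mul,
      Sf_shift m (n + 1) _ (Qs m (k - 1) n) (Qs_out _ _ _ _ (by omega)),
      Sf_succ m (n + 1) _ (Qs m k n) (Qs_out _ _ _ _ (by push_cast; omega))] at h4
    simp only [Nat.cast_zero, add_zero] at h4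
    rw [Sf_G, Sf_G] at h4
    have h5 : a - psi m n k = -phi m n (k - 1) := by
      rw [phi, ← mul_neg, eq_inv_mul_iff_mul_eq₀ hG1]
      exact eq_neg_of_add_eq_zero_right h4
    rw [sub_eq_iff_eq_add] at h5
    rw [h5]
    abel
  rw [← key, h2]
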